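/- Let b(n) be the number of L-submodules M ⊆ L with |L/M| = p^n, and c(n) the number of those that are free as L-modules. Then the sequence of real numbers c(n)/b(n) converges, as n → ∞, to 1 − 1/p. (The density of cohomologically trivial rank-1 quotients of ℤ_p[G] is 1 − p^{−1}.) -/

import Mathlib

noncomputable section

/-- The group algebra `ℤ_p[G]` for `G` cyclic of order `p`. -/
abbrev L (p : ℕ) [Fact p.Prime] : Type := MonoidAlgebra (PadicInt p) (Multiplicative (ZMod p))

/-- The fixed generator `g` of `G`, viewed inside `L = ℤ_p[G]`. -/
def gL (p : ℕ) [Fact p.Prime] : L p :=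
  MonoidAlgebra.of (PadicInt p) (Multiplicative (ZMod p)) (Multiplicative.ofAdd 1)

/-- The norm element `N = 1 + g + ⋯ + g^(p-1)` of `L`. -/
def NL (p : ℕ) [Fact p.Prime] : L p := ∑ i ∈ Finset.range p, gL p ^ i


/-- `e ∈ L` is a norm-lift if `p·1 = e·(g−1)^(p−1) + α·N` for some `α ∈ ℤ_p`. -/
def IsNormLift (p : ℕ) [Fact p.Prime] (e : L p) : Prop :=
  ∃ α : PadicInt p, (p : L p) = e * (gL p - 1) ^ (p - 1) + α • NL p

/-- The submodule `(g−1)A` of an `ℤ_p[G]`-module `A`. -/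
def commSub (p : ℕ) [Fact p.Prime] (A : Type) [AddCommGroup A] [Module (L p) A] :
    Submodule (L p) A :=
  LinearMap.range (LinearMap.lsmul (L p) A (gL p - 1))

/-- The fixed-point submodule `A^G = {x ∈ A : g·x = x}` of an `ℤ_p[G]`-module `A`. -/
def fixedSub (p : ℕ) [Fact p.Prime] (A : Type) [AddCommGroup A] [Module (L p) A] :
    Submodule (L p) A :=
  LinearMap.ker (LinearMap.lsmul (L p) A (gL p - 1))

/-- An `ℤ_p[G]`-module has rank 1 if it is nonzero and generated by a single element. -/
def IsRankOne (p : ℕ) [Fact p.Prime] (A : Type) [AddCommGroup A] [Module (L p) A] : Prop :=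
  Nontrivial A ∧ ∃ a : A, Submodule.span (L p) {a} = ⊤

set_option linter.unusedSectionVars false

structure Node (R : Type) [CommRing R] [IsLocalRing R] (x y : R) : Prop where
  xy : x * y = 0
  mx : ∀ a : R, ¬ IsUnit a → ∃ b c, a = b * x + c * y
  xn : ∀ k, x ^ k ≠ 0
  yn : ∀ k, y ^ k ≠ 0
  hx : ¬ IsUnit x
  hy : ¬ IsUnit y

namespace Node
variable {R : Type} [CommRing R] [IsLocalRing R] {x y : R}

theorem symm (h : Node R x y) : Node R y x where
  xy := by rw [mul_comm]; exact h.xy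
  mx a ha := by
    obtain ⟨b, c, e⟩ := h.mx a ha
    exact ⟨c, b, by rw [e]; ring⟩
  xn := h.yn
  yn := h.xn
  hx := h.hy
  hy := h.hx

theorem unit_of (h : Node R x y) {a : R} {k : ℕ} : IsUnit a → a * x ^ k ≠ 0 := by
  intro ha e
  exact h.xn k ((ha.mul_right_eq_zero).1 e)

/-- a nonunit times a positive power -/
theorem nonunit_mul (h : Node R x y) {a : R} (ha : ¬ IsUnit a) (k : ℕ) :
    ∃ b, a * x ^ (k + 1) = b * x ^ (k + 2) := by
  obtain ⟨b, c, e⟩ := h.mx a ha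
  refine ⟨b, ?_⟩
  rw [e]
  have := h.xy
  linear_combination c * x ^ k * this

theorem one_sub (a b : R) (ha : ¬ IsUnit a) : IsUnit (1 - a * b) := by
  apply (IsLocalRing.isUnit_or_isUnit_one_sub_self (a * b)).resolve_left
  intro hu
  exact ha (isUnit_of_mul_isUnit_left hu)

theorem dich (h : Node R x y) (a : R) (n : ℕ) :
    (∃ b, a * x = b * x ^ (n + 1)) ∨ ∃ u m, IsUnit u ∧ a * x = u * x ^ (m + 1) ∧ m < n := by
  induction n with
  | zero => exact Or.inl ⟨a, by simp⟩
  | succ n ih =>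
    rcases ih with ⟨b, hb⟩ | ⟨u, m, hu, e, hm⟩
    · by_cases hu : IsUnit b
      · exact Or.inr ⟨b, n, hu, hb, by omega⟩
      · obtain ⟨c, hc⟩ := h.nonunit_mul hu n
        exact Or.inl ⟨c, by rw [hb, hc]⟩
    · exact Or.inr ⟨u, m, hu, e, by omega⟩

/-- nondegeneracy -/
theorem nd (h : Node R x y) {i i' : ℕ} {b c : R} (e : x ^ i = b * x ^ i' + c * y) : i' ≤ i := by
  by_contra hlt
  obtain ⟨d, rfl⟩ : ∃ d, i' = i + 1 + d := ⟨i' - i - 1, by omega⟩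
  have h1 : IsUnit (1 - x * (b * x ^ d)) := one_sub _ _ h.hx
  refine h.unit_of (k := i + 1) h1 ?_
  have := h.xy
  linear_combination x * e + c * this

def Q (x y : R) (i j : ℕ) : Ideal R := Ideal.span {x ^ i, y ^ j}
def P (x y : R) (i j : ℕ) (t : R) : Ideal R := Ideal.span {x ^ i + t * y ^ j}

theorem Q_comm (i j : ℕ) : Q x y i j = Q y x j i := by
  unfold Q; rw [Set.pair_comm]

theorem mem_Q {i j : ℕ} {z : R} : z ∈ Q x y i j ↔ ∃ a b, a * x ^ i + b * y ^ j = z :=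
  Ideal.mem_span_pair

theorem mem_P {i j : ℕ} {t z : R} : z ∈ P x y i j t ↔ ∃ a, a * (x ^ i + t * y ^ j) = z :=
  Ideal.mem_span_singleton'

theorem y_notMem_P (h : Node R x y) {i j : ℕ} {t : R} (hj : 0 < j) :
    y ^ j ∉ P x y (i + 1) j t := by
  rw [mem_P]
  rintro ⟨a, ha⟩
  obtain ⟨j, rfl⟩ : ∃ k, j = k + 1 := ⟨j - 1, by omega⟩
  have hxy := h.xy
  have h1 : a * x ^ (i + 2) = 0 := by
    linear_combination x * ha + (y ^ j - a * t * y ^ j) * hxy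
  have h2 : ¬ IsUnit a := fun hu => h.unit_of hu h1
  have h3 := one_sub a t h2
  refine h.symm.unit_of (k := j + 2) h3 ?_
  linear_combination -y * ha + (a * x ^ i) * hxy

theorem P_le_Q {i j : ℕ} {t : R} : P x y i j t ≤ Q x y i j := by
  unfold P
  rw [Ideal.span_singleton_le_iff_mem, mem_Q]
  exact ⟨1, t, by ring⟩

theorem Q_ne {i j i' j' : ℕ} (h : Node R x y) (hj' : 0 < j')
    (e : Q x y i j ≤ Q x y i' j') : i' ≤ i := by
  have : x ^ i ∈ Q x y i' j' := e (mem_Q.2 ⟨1, 0, by ring⟩)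
  obtain ⟨a, b, hab⟩ := mem_Q.1 this
  obtain ⟨j, rfl⟩ : ∃ k, j' = k + 1 := ⟨j' - 1, by omega⟩
  exact h.nd (b := a) (c := b * y ^ j) (by rw [← hab]; ring)

theorem P_ne {i j i' j' : ℕ} {t t' : R} (h : Node R x y) (hj : 0 < j) (hj' : 0 < j')
    (e : P x y i j t ≤ P x y i' j' t') : i' ≤ i := by
  have : x ^ i + t * y ^ j ∈ Q x y i' j' := P_le_Q (e (mem_P.2 ⟨1, by ring⟩))
  obtain ⟨a, b, hab⟩ := mem_Q.1 this
  obtain ⟨j, rfl⟩ : ∃ k, j = k + 1 := ⟨j - 1, by omega⟩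
  obtain ⟨j', rfl⟩ : ∃ k, j' = k + 1 := ⟨j' - 1, by omega⟩
  exact h.nd (b := a) (c := b * y ^ j' - t * y ^ j) (by linear_combination -hab)

theorem P_inj {i j : ℕ} {t t' : R} (h : Node R x y) (hj : 0 < j)
    (e : P x y (i + 1) j t' ≤ P x y (i + 1) j t) : ¬ IsUnit (t - t') := by
  intro hu
  have h1 : x ^ (i + 1) + t' * y ^ j ∈ P x y (i + 1) j t := e (mem_P.2 ⟨1, by ring⟩)
  have h2 : x ^ (i + 1) + t * y ^ j ∈ P x y (i + 1) j t := mem_P.2 ⟨1, by ring⟩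
  have h3 : (t - t') * y ^ j ∈ P x y (i + 1) j t := by
    have := sub_mem h2 h1
    ring_nf at this ⊢
    exact this
  exact h.y_notMem_P hj ((Ideal.unit_mul_mem_iff_mem _ hu).1 h3)

/-- index step -/
theorem card_step (J I : Ideal R) (w : R) (hI : I = J ⊔ Ideal.span {w}) (hw : w ∉ J)
    (hm : ∀ a, ¬ IsUnit a → a * w ∈ J) :
    Nat.card (R ⧸ J) = Nat.card (IsLocalRing.ResidueField R) * Nat.card (R ⧸ I) := by
  let φ : R →ₗ[R] R ⧸ J := J.mkQ ∘ₗ LinearMap.toSpanSingleton R R w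
  have hker : LinearMap.ker φ = IsLocalRing.maximalIdeal R := by
    ext a
    have : a ∈ LinearMap.ker φ ↔ a * w ∈ J := by
      rw [← Ideal.Quotient.eq_zero_iff_mem (I := J), LinearMap.mem_ker]
      rfl
    rw [this, IsLocalRing.mem_maximalIdeal, mem_nonunits_iff]
    constructor
    · intro h hu
      exact hw ((Ideal.unit_mul_mem_iff_mem _ hu).1 h)
    · exact hm a
  have hrange : LinearMap.range φ = Submodule.map J.mkQ I := by
    rw [LinearMap.range_comp, LinearMap.range_toSpanSingleton, hI, Submodule.map_sup]
    have : Submodule.map J.mkQ J = ⊥ := by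
      rw [← LinearMap.le_ker_iff_map]; simp
    rw [this, bot_sup_eq]
  have hJI : J ≤ I := hI ▸ le_sup_left
  have e1 := Submodule.card_eq_card_quotient_mul_card (LinearMap.range φ)
  have e2 : Nat.card (LinearMap.range φ) = Nat.card (IsLocalRing.ResidueField R) := by
    rw [← Nat.card_congr φ.quotKerEquivRange.toEquiv, hker]; rfl
  have e3 : Nat.card ((R ⧸ J) ⧸ LinearMap.range φ) = Nat.card (R ⧸ I) := by
    rw [hrange]
    exact Nat.card_congr (Submodule.quotientQuotientEquivQuotient J I hJI).toEquiv
  rw [e1, e2, e3]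
  try ring

theorem max_eq (h : Node R x y) : Q x y 1 1 = IsLocalRing.maximalIdeal R := by
  ext z
  rw [mem_Q, IsLocalRing.mem_maximalIdeal, mem_nonunits_iff]
  constructor
  · rintro ⟨a, b, rfl⟩
    have hx : x ∈ IsLocalRing.maximalIdeal R := h.hx
    have hy : y ∈ IsLocalRing.maximalIdeal R := h.hy
    have : a * x ^ 1 + b * y ^ 1 ∈ IsLocalRing.maximalIdeal R := by
      rw [pow_one, pow_one]
      exact add_mem (Ideal.mul_mem_left _ _ hx) (Ideal.mul_mem_left _ _ hy)
    exact this
  · intro hz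
    obtain ⟨b, c, e⟩ := h.mx z hz
    exact ⟨b, c, by rw [e]; ring⟩

theorem card_Q_succ (h : Node R x y) (i j : ℕ) :
    Nat.card (R ⧸ Q x y (i + 2) (j + 1)) =
      Nat.card (IsLocalRing.ResidueField R) * Nat.card (R ⧸ Q x y (i + 1) (j + 1)) := by
  refine card_step _ _ (x ^ (i + 1)) ?_ ?_ ?_
  · apply le_antisymm
    · unfold Q
      rw [Ideal.span_le]
      rintro z (rfl | rfl)
      · exact Ideal.mem_sup_right (Ideal.mem_span_singleton_self _)
      · exact Ideal.mem_sup_left (Ideal.subset_span (by simp))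
    · refine sup_le ?_ ?_
      · intro z hz
        obtain ⟨a, b, rfl⟩ := mem_Q.1 hz
        exact mem_Q.2 ⟨a * x, b, by ring⟩
      · rw [Ideal.span_singleton_le_iff_mem]
        exact mem_Q.2 ⟨1, 0, by ring⟩
  · intro hm
    obtain ⟨a, b, e⟩ := mem_Q.1 hm
    have := h.nd (i := i + 1) (i' := i + 2) (b := a) (c := b * y ^ j) (by rw [← e]; ring)
    omega
  · intro a ha
    obtain ⟨b, hb⟩ := h.nonunit_mul ha i
    exact mem_Q.2 ⟨b, 0, by rw [hb]; ring⟩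

theorem card_Q (h : Node R x y) (i j : ℕ) :
    Nat.card (R ⧸ Q x y (i + 1) (j + 1)) = Nat.card (IsLocalRing.ResidueField R) ^ (i + j + 1) := by
  induction i with
  | zero =>
    induction j with
    | zero => rw [h.max_eq]; simp; rfl
    | succ j ih =>
      rw [Q_comm, h.symm.card_Q_succ, ← Q_comm, ih]; ring
  | succ i ih => rw [h.card_Q_succ, ih]; ring

theorem card_P (h : Node R x y) (i j : ℕ) {t : R} (ht : IsUnit t) :
    Nat.card (R ⧸ P x y (i + 1) (j + 1) t) =
      Nat.card (IsLocalRing.ResidueField R) ^ (i + j + 2) := by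
  rw [card_step (P x y (i + 1) (j + 1) t) (Q x y (i + 1) (j + 1)) (y ^ (j + 1)), h.card_Q]
  · ring
  · apply le_antisymm
    · intro z hz
      obtain ⟨a, b, rfl⟩ := mem_Q.1 hz
      have : a * x ^ (i + 1) + b * y ^ (j + 1) =
        a * (x ^ (i + 1) + t * y ^ (j + 1)) + (b - a * t) * y ^ (j + 1) := by ring
      rw [this]
      exact Submodule.add_mem_sup (mem_P.2 ⟨a, rfl⟩) (Ideal.mem_span_singleton'.2 ⟨_, rfl⟩)
    · refine sup_le P_le_Q ?_
      rw [Ideal.span_singleton_le_iff_mem]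
      exact mem_Q.2 ⟨0, 1, by ring⟩
  · exact h.y_notMem_P (by omega)
  · intro a ha
    obtain ⟨b, hb⟩ := h.symm.nonunit_mul ha j
    rw [hb]
    obtain ⟨s, hs⟩ := ht.exists_left_inv
    refine mem_P.2 ⟨b * s * y, ?_⟩
    have hxy := h.xy
    linear_combination (b * s * x ^ i) * hxy + b * y ^ (j + 2) * hs

theorem not_free_Q (h : Node R x y) (i j : ℕ) :
    ¬ Module.Free R (Q x y (i + 1) (j + 1)) := by
  intro hf
  obtain ⟨⟨ι, b⟩⟩ := hf.exists_basis
  have hss : Subsingleton ι := by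
    refine ⟨fun k l => ?_⟩
    by_contra hkl
    have e : ((b l : R) • b k) = ((b k : R) • b l) := by
      ext; simp [mul_comm]
    have e2 := congrArg (fun v => b.repr v k) e
    have e4 := congrArg (fun v => b.repr v l) e
    simp [hkl, Ne.symm hkl] at e2 e4
    exact b.ne_zero l (by ext; simpa using e2)
  have hxm : x ^ (i + 1) ∈ Q x y (i + 1) (j + 1) := mem_Q.2 ⟨1, 0, by ring⟩
  have hym : y ^ (j + 1) ∈ Q x y (i + 1) (j + 1) := mem_Q.2 ⟨0, 1, by ring⟩
  have hz : ∃ z : R, z ∈ Q x y (i + 1) (j + 1) ∧ ∀ w ∈ Q x y (i + 1) (j + 1), ∃ a, w = a * z := by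
    rcases isEmpty_or_nonempty ι with hE | ⟨⟨k⟩⟩
    · exfalso
      have := b.repr.injective (Subsingleton.elim (b.repr ⟨_, hxm⟩) (b.repr 0))
      exact h.xn (i + 1) (congrArg Subtype.val this)
    · refine ⟨b k, (b k).2, fun w hw => ⟨b.repr ⟨w, hw⟩ k, ?_⟩⟩
      have : Unique ι := ⟨⟨k⟩, fun _ => Subsingleton.elim _ _⟩
      have e := b.sum_repr ⟨w, hw⟩
      rw [Fintype.sum_subsingleton _ k] at e
      exact (congrArg Subtype.val e).symm
  obtain ⟨z, hzQ, hz⟩ := hz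
  obtain ⟨a, ha⟩ := hz _ hxm
  obtain ⟨c, hc⟩ := hz _ hym
  obtain ⟨u, v, e⟩ := mem_Q.1 hzQ
  have hxy := h.xy
  have ua : IsUnit a := by
    by_contra hn
    refine h.unit_of (k := i + 2) (one_sub a u hn) ?_
    linear_combination x * ha - a * x * e + a * v * y ^ j * hxy
  have uc : IsUnit c := by
    by_contra hn
    refine h.symm.unit_of (k := j + 2) (one_sub c v hn) ?_
    linear_combination y * hc - c * y * e + c * u * x ^ i * hxy
  have h0 : a * (c * (z * z)) = 0 := by
    linear_combination -(c * z) * ha - x ^ (i + 1) * hc + x ^ i * y ^ j * hxy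
  rw [ua.mul_right_eq_zero, uc.mul_right_eq_zero] at h0
  refine h.xn (i + 1 + (i + 1)) ?_
  rw [pow_add, ha]
  linear_combination a * a * h0

theorem mul_x_zero (h : Node R x y) [IsNoetherianRing R] {a : R} {k : ℕ}
    (e : a * x ^ (k + 1) = 0) : a * x = 0 := by
  have hk := Ideal.iInf_pow_eq_bot_of_isLocalRing (IsLocalRing.maximalIdeal R)
    (Ideal.IsPrime.ne_top inferInstance)
  rw [← Ideal.mem_bot, ← hk, Ideal.mem_iInf]
  intro n
  rcases h.dich a n with ⟨b, hb⟩ | ⟨u, m, hu, hm, _⟩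
  · rw [hb, pow_succ, mul_left_comm]
    apply Ideal.mul_mem_right
    exact Ideal.pow_mem_pow h.hx n
  · exfalso
    refine h.unit_of (k := m + 1 + k) hu ?_
    linear_combination e - x ^ k * hm

theorem free_P (h : Node R x y) [IsNoetherianRing R] (i j : ℕ) {t : R} (ht : IsUnit t) :
    Module.Free R (P x y (i + 1) (j + 1) t) := by
  have hxy := h.xy
  have hinj : Function.Injective
      (LinearMap.toSpanSingleton R R (x ^ (i + 1) + t * y ^ (j + 1))) := by
    rw [injective_iff_map_eq_zero]
    intro r hr
    simp only [LinearMap.toSpanSingleton_apply, smul_eq_mul] at hr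
    have h1 : r * x ^ (i + 2) = 0 := by linear_combination x * hr - r * t * y ^ j * hxy
    have h2' : t * (r * y ^ (j + 2)) = 0 := by linear_combination y * hr - r * x ^ i * hxy
    have h2 := (ht.mul_right_eq_zero).1 h2'
    have hn : ¬ IsUnit r := fun hu => h.unit_of hu h1
    obtain ⟨b, c, e⟩ := h.mx r hn
    have h3 : b * x ^ (i + 2 + 1) = 0 := by
      rw [e] at h1; linear_combination h1 - c * x ^ (i + 1) * hxy
    have h4 : c * y ^ (j + 2 + 1) = 0 := by
      rw [e] at h2; linear_combination h2 - b * y ^ (j + 1) * hxy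
    rw [e, h.mul_x_zero h3, h.symm.mul_x_zero h4, add_zero]
  have e := LinearEquiv.ofInjective _ hinj
  rw [LinearMap.range_toSpanSingleton] at e
  exact Module.Free.of_equiv e

theorem pow_mem (I : Ideal R) [Finite (R ⧸ I)] {x : R} (hx : ¬ IsUnit x) : ∃ k, x ^ k ∈ I := by
  obtain ⟨a, b, hab, e⟩ := Finite.exists_ne_map_eq_of_infinite
    (fun k : ℕ => Ideal.Quotient.mk I (x ^ k))
  wlog hlt : a < b generalizing a b
  · exact this b a hab.symm e.symm (by omega)
  obtain ⟨d, rfl⟩ : ∃ d, b = a + (d + 1) := ⟨b - a - 1, by omega⟩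
  rw [Ideal.Quotient.eq] at e
  refine ⟨a, ?_⟩
  have hu := one_sub x (x ^ d) hx
  rw [← Ideal.unit_mul_mem_iff_mem _ hu]
  convert e using 1
  ring

theorem exists_i (h : Node R x y) (I : Ideal R) (hI : I ≠ ⊤) [Finite (R ⧸ I)] :
    ∃ i, (∃ c, x ^ (i + 1) + c * y ∈ I) ∧ ∀ z ∈ I, ∃ a b, z = a * x ^ (i + 1) + b * y := by
  classical
  have hex : ∃ k, ∃ c, x ^ k + c * y ∈ I := by
    obtain ⟨k, hk⟩ := pow_mem I h.hx
    exact ⟨k, 0, by simpa using hk⟩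
  have hmin := fun m => Nat.find_min (m := m) hex
  have hsp := Nat.find_spec hex
  generalize Nat.find hex = i at hmin hsp
  rcases i with _ | i
  · exfalso
    obtain ⟨c, hc⟩ := hsp
    refine hI (Ideal.eq_top_of_isUnit_mem _ hc ?_)
    have := one_sub y (-c) h.hy
    convert this using 1
    ring
  · refine ⟨i, hsp, fun z hz => ?_⟩
    have hn : ¬ IsUnit z := fun hu => hI (Ideal.eq_top_of_isUnit_mem _ hz hu)
    obtain ⟨b, c, e⟩ := h.mx z hn
    rcases h.dich b i with ⟨b', hb⟩ | ⟨u, m, hu, hm, hlt⟩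
    · exact ⟨b', c, by rw [e, hb]⟩
    · exfalso
      obtain ⟨s, hs⟩ := hu.exists_left_inv
      refine hmin (m + 1) (by omega) ⟨s * c, ?_⟩
      have := I.mul_mem_left s hz
      convert this using 1
      rw [e, hm]
      linear_combination -x ^ (m + 1) * hs

theorem classify (h : Node R x y) (I : Ideal R) (hI : I ≠ ⊤) [Finite (R ⧸ I)]
    (τ : IsLocalRing.ResidueField R → R) (hτ : ∀ a, IsLocalRing.residue R (τ a) = a) :
    ∃ i j, I = Q x y (i + 1) (j + 1) ∨
      ∃ t : (IsLocalRing.ResidueField R)ˣ, I = P x y (i + 1) (j + 1) (τ t) := by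
  obtain ⟨i, ⟨c, hc⟩, hi⟩ := h.exists_i I hI
  obtain ⟨j, ⟨d, hd⟩, hj⟩ := h.symm.exists_i I hI
  have hxy := h.xy
  refine ⟨i, j, ?_⟩
  have hx1 : x ^ (i + 2) ∈ I := by
    convert I.mul_mem_left x hc using 1
    linear_combination -c * hxy
  have hy1 : y ^ (j + 2) ∈ I := by
    convert I.mul_mem_left y hd using 1
    linear_combination -d * hxy
  have hIQ : ∀ z ∈ I, ∃ a b, z = a * x ^ (i + 1) + b * y ^ (j + 1) := by
    intro z hz
    obtain ⟨a, b, e⟩ := hi z hz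
    obtain ⟨a', b', e'⟩ := hj z hz
    rcases h.symm.dich b j with ⟨b'', hb⟩ | ⟨u, m, hu, hm, hlt⟩
    · exact ⟨a, b'', by rw [e, hb]⟩
    · exfalso
      obtain ⟨s, hs⟩ := hu.exists_left_inv
      have := h.symm.nd (i := m + 1) (i' := j + 1) (b := s * a') (c := s * (b' - a * x ^ i)) (by
        linear_combination -y ^ (m + 1) * hs - s * hm - s * e + s * e')
      omega
  have hnx : ∀ a, ¬ IsUnit a → a * x ^ (i + 1) ∈ I := by
    intro a ha
    obtain ⟨b, hb⟩ := h.nonunit_mul ha i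
    rw [hb]; exact I.mul_mem_left _ hx1
  have hny : ∀ a, ¬ IsUnit a → a * y ^ (j + 1) ∈ I := by
    intro a ha
    obtain ⟨b, hb⟩ := h.symm.nonunit_mul ha j
    rw [hb]; exact I.mul_mem_left _ hy1
  have hx2 : ∃ b, x ^ (i + 1) + b * y ^ (j + 1) ∈ I := by
    obtain ⟨a, b, e⟩ := hIQ _ hc
    have hna : ¬ IsUnit (1 - a) := by
      intro hu
      refine h.unit_of (k := i + 2) hu ?_
      linear_combination x * e + (b * y ^ j - c) * hxy
    refine ⟨b, ?_⟩
    have := add_mem hc (hnx _ hna)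
    rw [e] at this
    convert this using 1
    ring
  have hy2 : ∃ b, y ^ (j + 1) + b * x ^ (i + 1) ∈ I := by
    obtain ⟨a, b, e⟩ := hIQ _ hd
    have hna : ¬ IsUnit (1 - b) := by
      intro hu
      refine h.symm.unit_of (k := j + 2) hu ?_
      linear_combination y * e + (a * x ^ i - d) * hxy
    refine ⟨a, ?_⟩
    have := add_mem hd (hny _ hna)
    rw [e] at this
    convert this using 1
    ring
  have hle : I ≤ Q x y (i + 1) (j + 1) := by
    intro z hz
    obtain ⟨a, b, e⟩ := hIQ z hz
    exact mem_Q.2 ⟨a, b, e.symm⟩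
  have hfull : x ^ (i + 1) ∈ I → I = Q x y (i + 1) (j + 1) := by
    intro hx3
    refine le_antisymm hle ?_
    obtain ⟨b, hb⟩ := hy2
    intro z hz
    obtain ⟨a, b', rfl⟩ := mem_Q.1 hz
    have := add_mem (I.mul_mem_left (a - b' * b) hx3) (I.mul_mem_left b' hb)
    convert this using 1
    ring
  obtain ⟨b, hb⟩ := hx2
  by_cases hu : IsUnit b
  · by_cases hxI : x ^ (i + 1) ∈ I
    · exact Or.inl (hfull hxI)
    right
    have hres : IsUnit (IsLocalRing.residue R b) := hu.map _
    refine ⟨hres.unit, ?_⟩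
    set t := τ hres.unit with htdef
    have htb : IsLocalRing.residue R t = IsLocalRing.residue R b := by
      rw [htdef, hτ]; rfl
    have htb' : ¬ IsUnit (t - b) := by
      rw [← mem_nonunits_iff, ← IsLocalRing.mem_maximalIdeal, ← IsLocalRing.residue_eq_zero_iff,
        map_sub, htb, sub_self]
    have htu : IsUnit t := by
      by_contra hn
      rw [← mem_nonunits_iff, ← IsLocalRing.mem_maximalIdeal, ← IsLocalRing.residue_eq_zero_iff,
        htb] at hn
      exact hres.ne_zero hn
    have hPI : x ^ (i + 1) + t * y ^ (j + 1) ∈ I := by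
      convert add_mem hb (hny _ htb') using 1
      ring
    refine le_antisymm ?_ ?_
    · intro z hz
      obtain ⟨a, c, e⟩ := hIQ z hz
      have hn : ¬ IsUnit (c - a * t) := by
        intro hu2
        have h5 : (c - a * t) * y ^ (j + 1) ∈ I := by
          convert sub_mem hz (I.mul_mem_left a hPI) using 1
          rw [e]; ring
        rw [Ideal.unit_mul_mem_iff_mem _ hu2] at h5
        apply hxI
        convert sub_mem hPI (I.mul_mem_left t h5) using 1
        ring
      obtain ⟨f, hf⟩ := h.symm.nonunit_mul hn j
      obtain ⟨s, hs⟩ := htu.exists_left_inv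
      refine mem_P.2 ⟨a + f * s * y, ?_⟩
      rw [e]
      linear_combination -hf + f * s * x ^ i * hxy + f * y ^ (j + 2) * hs
    · unfold P
      rw [Ideal.span_singleton_le_iff_mem]
      exact hPI
  · left
    apply hfull
    convert sub_mem hb (hny _ hu) using 1
    ring

end Node

open Node in
theorem Node.count {R : Type} [CommRing R] [IsLocalRing R] [IsNoetherianRing R] {x y : R}
    (h : Node R x y) (p : ℕ) (hp : p.Prime) (hk : Nat.card (IsLocalRing.ResidueField R) = p)
    (n : ℕ) :
    Nat.card {M : Submodule R R // Nat.card (R ⧸ M) = p ^ (n + 1) ∧ Module.Free R M} = n * (p - 1)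
    ∧ Nat.card {M : Submodule R R // Nat.card (R ⧸ M) = p ^ (n + 1)} = n * (p - 1) + (n + 1) := by
  classical
  have hfin : Finite (IsLocalRing.ResidueField R) :=
    Nat.finite_of_card_ne_zero (by rw [hk]; exact hp.ne_zero)
  have := Fintype.ofFinite (IsLocalRing.ResidueField R)
  have hku : Nat.card (IsLocalRing.ResidueField R)ˣ = p - 1 := by
    rw [Nat.card_units, hk]
  set τ : IsLocalRing.ResidueField R → R := Function.surjInv IsLocalRing.residue_surjective
  have hτ : ∀ a, IsLocalRing.residue R (τ a) = a :=
    Function.surjInv_eq IsLocalRing.residue_surjective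
  have hτu : ∀ t : (IsLocalRing.ResidueField R)ˣ, IsUnit (τ t) := by
    intro t
    by_contra hn
    rw [← mem_nonunits_iff, ← IsLocalRing.mem_maximalIdeal, ← IsLocalRing.residue_eq_zero_iff,
        hτ] at hn
    exact t.ne_zero hn
  let F : Fin n × (IsLocalRing.ResidueField R)ˣ → Submodule R R :=
    fun q => P x y (q.1 + 1) (n - 1 - q.1 + 1) (τ q.2)
  let H : Fin (n + 1) → Submodule R R := fun q => Q x y (q + 1) (n - q + 1)
  have hF : Function.Injective F := by
    rintro ⟨k, t⟩ ⟨l, s⟩ e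
    have e' : P x y (k + 1) (n - 1 - k + 1) (τ t) = P x y (l + 1) (n - 1 - l + 1) (τ s) := e
    have h1 := h.P_ne (by omega) (by omega) e'.le
    have h2 := h.P_ne (by omega) (by omega) e'.ge
    have h3 : k = l := Fin.ext (by omega)
    subst h3
    have h4 := h.P_inj (by omega) e'.le
    rw [← mem_nonunits_iff, ← IsLocalRing.mem_maximalIdeal, ← IsLocalRing.residue_eq_zero_iff,
      map_sub, hτ, hτ, sub_eq_zero] at h4
    rw [Units.ext h4]
  have hH : Function.Injective H := by
    intro k l e
    have e' : Q x y (k + 1) (n - k + 1) = Q x y (l + 1) (n - l + 1) := e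
    have h1 := h.Q_ne (by omega) e'.le
    have h2 := h.Q_ne (by omega) e'.ge
    exact Fin.ext (by omega)
  have hFc : ∀ q, Nat.card (R ⧸ F q) = p ^ (n + 1) ∧ Module.Free R (F q) := by
    rintro ⟨k, t⟩
    refine ⟨?_, h.free_P _ _ (hτu t)⟩
    have := h.card_P k (n - 1 - k) (hτu t)
    rw [hk] at this
    have hkn := k.2
    rw [show (k : ℕ) + (n - 1 - k) + 2 = n + 1 by omega] at this
    exact this
  have hHc : ∀ q, Nat.card (R ⧸ H q) = p ^ (n + 1) ∧ ¬ Module.Free R (H q) := by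
    intro k
    refine ⟨?_, h.not_free_Q _ _⟩
    have := h.card_Q k (n - k)
    rw [hk] at this
    have hkn := k.2
    rw [show (k : ℕ) + (n - k) + 1 = n + 1 by omega] at this
    exact this
  have hcl : ∀ M : Submodule R R, Nat.card (R ⧸ M) = p ^ (n + 1) →
      M ∈ Set.range F ∨ M ∈ Set.range H := by
    intro M hM
    have hf : Finite (R ⧸ M) := Nat.finite_of_card_ne_zero (by rw [hM]; exact pow_ne_zero _ hp.ne_zero)
    have hne : M ≠ ⊤ := by
      rintro rfl
      have h1 : Nat.card (R ⧸ (⊤ : Submodule R R)) = 1 := Nat.card_unique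
      rw [hM] at h1
      exact (Nat.one_lt_pow (Nat.succ_ne_zero n) hp.one_lt).ne' h1
    obtain ⟨i, j, e | ⟨t, e⟩⟩ := h.classify M hne τ hτ
    · right
      have h1 := h.card_Q i j
      rw [← e, hk] at h1
      have h2 := Nat.pow_right_injective hp.two_le (hM.symm.trans h1)
      refine ⟨⟨i, by omega⟩, ?_⟩
      rw [e]
      simp only [H]
      congr 2; omega
    · left
      have h1 := h.card_P i j (hτu t)
      rw [← e, hk] at h1
      have h2 := Nat.pow_right_injective hp.two_le (hM.symm.trans h1)
      refine ⟨⟨⟨i, by omega⟩, t⟩, ?_⟩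
      rw [e]
      simp only [F]
      congr 2; omega
  have s1 : {M : Submodule R R | Nat.card (R ⧸ M) = p ^ (n + 1) ∧ Module.Free R M} = Set.range F := by
    ext M
    constructor
    · rintro ⟨h1, h2⟩
      rcases hcl M h1 with h3 | ⟨q, rfl⟩
      · exact h3
      · exact absurd h2 (hHc q).2
    · rintro ⟨q, rfl⟩
      exact hFc q
  have s2 : {M : Submodule R R | Nat.card (R ⧸ M) = p ^ (n + 1)} = Set.range F ∪ Set.range H := by
    ext M
    constructor
    · exact hcl M
    · rintro (⟨q, rfl⟩ | ⟨q, rfl⟩)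
      · exact (hFc q).1
      · exact (hHc q).1
  have hdis : Disjoint (Set.range F) (Set.range H) := by
    rw [Set.disjoint_left]
    rintro _ ⟨q, rfl⟩ ⟨r, e⟩
    exact (hHc r).2 (e ▸ (hFc q).2)
  have n1 : (Set.range F).ncard = n * (p - 1) := by
    rw [← Nat.card_coe_set_eq, Nat.card_range_of_injective hF, Nat.card_prod, hku, Nat.card_fin]
  have n2 : (Set.range H).ncard = n + 1 := by
    rw [← Nat.card_coe_set_eq, Nat.card_range_of_injective hH, Nat.card_fin]
  constructor
  · rw [← n1, ← s1, ← Nat.card_coe_set_eq]; rfl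
  · have n3 := Set.ncard_union_eq hdis (Set.finite_range F) (Set.finite_range H)
    rw [n1, n2, ← s2, ← Nat.card_coe_set_eq] at n3
    exact n3

section LPart
variable (p : ℕ) [hp : Fact p.Prime]

def augL : L p →ₐ[PadicInt p] PadicInt p := MonoidAlgebra.lift _ _ _ 1

theorem augL_g : augL p (gL p) = 1 := by simp [augL, gL]

theorem gL_pow (k : ℕ) : gL p ^ k =
    MonoidAlgebra.of (PadicInt p) (Multiplicative (ZMod p)) (Multiplicative.ofAdd (k : ZMod p)) := by
  rw [gL, ← map_pow, ← ofAdd_nsmul]; simp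

theorem gL_pow_p : gL p ^ p = 1 := by
  rw [gL_pow, ZMod.natCast_self, ofAdd_zero, map_one]

theorem NL_mul : NL p * (gL p - 1) = 0 := by
  rw [NL, geom_sum_mul, gL_pow_p, sub_self]

theorem augL_N : augL p (NL p) = p := by
  simp [NL, augL_g]

theorem sub_augL (z : L p) : ∃ h, z = algebraMap _ _ (augL p z) + h * (gL p - 1) := by
  induction z using MonoidAlgebra.induction_on with
  | of m =>
    obtain ⟨k, hk⟩ := ZMod.natCast_zmod_surjective (n := p) m.toAdd
    have : MonoidAlgebra.of (PadicInt p) (Multiplicative (ZMod p)) m = gL p ^ k := by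
      rw [gL_pow, hk]; rfl
    rw [this, map_pow, augL_g, one_pow, map_one]
    exact ⟨∑ i ∈ Finset.range k, gL p ^ i, by rw [geom_sum_mul]; ring⟩
  | add a b ha hb =>
    obtain ⟨h1, e1⟩ := ha
    obtain ⟨h2, e2⟩ := hb
    refine ⟨h1 + h2, ?_⟩
    rw [map_add, map_add]
    linear_combination e1 + e2
  | smul r f hf =>
    obtain ⟨h1, e1⟩ := hf
    refine ⟨algebraMap _ _ r * h1, ?_⟩
    rw [map_smul, smul_eq_mul, map_mul, Algebra.smul_def]
    linear_combination algebraMap _ _ r * e1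

theorem s_not_nil (k : ℕ) : (gL p - 1) ^ k ≠ 0 := by
  intro e
  obtain ⟨ζ, hζ⟩ := HasEnoughRootsOfUnity.exists_primitiveRoot (AlgebraicClosure ℚ_[p]) p
  let φ : L p →ₐ[PadicInt p] AlgebraicClosure ℚ_[p] :=
    MonoidAlgebra.lift _ _ _ (AddChar.zmodChar p hζ.pow_eq_one).toMonoidHom
  have h1 : φ (gL p) = ζ := by
    simp only [φ, gL, MonoidAlgebra.lift_of]
    have := AddChar.zmodChar_apply' hζ.pow_eq_one 1
    simpa using this
  have h2 := congrArg φ e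
  rw [map_pow, map_sub, h1, map_one, map_zero] at h2
  exact hζ.ne_one hp.out.one_lt (sub_eq_zero.1 (eq_zero_of_pow_eq_zero h2))

theorem N_not_nil (k : ℕ) : NL p ^ k ≠ 0 := by
  intro e
  have := congrArg (augL p) e
  rw [map_pow, augL_N, map_zero] at this
  exact pow_ne_zero k (by exact_mod_cast hp.out.ne_zero) this

theorem s_pow_p : ∃ r, (gL p - 1) ^ p = p * r := by
  obtain ⟨r, hr⟩ := exists_add_pow_prime_eq hp.out (gL p - 1) 1
  rw [sub_add_cancel, gL_pow_p, one_pow] at hr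
  exact ⟨-((gL p - 1) * 1 * r), by linear_combination -hr⟩

instance finL : Module.Finite (PadicInt p) (L p) := inferInstance

instance noethL : IsNoetherianRing (L p) := IsNoetherianRing.of_finite (PadicInt p) (L p)

theorem isUnit_L (z : L p) (hz : IsUnit (augL p z)) : IsUnit z := by
  obtain ⟨h, e⟩ := sub_augL p z
  obtain ⟨r, hr⟩ := exists_add_pow_prime_eq hp.out (algebraMap _ (L p) (augL p z)) (h * (gL p - 1))
  obtain ⟨r', hr'⟩ := s_pow_p p
  rw [← e, mul_pow, hr'] at hr
  obtain ⟨v, hv⟩ := (hz.map (algebraMap _ (L p))).exists_left_inv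
  have hvp : v ^ p * (algebraMap _ (L p) (augL p z)) ^ p = 1 := by rw [← mul_pow, hv, one_pow]
  have key : ∃ w r, (1 : L p) = z * w + p * r := by
    refine ⟨v ^ p * z ^ (p - 1),
      -v ^ p * (h ^ p * r' + (algebraMap _ (L p) (augL p z)) * (h * (gL p - 1)) * r), ?_⟩
    have : z * (v ^ p * z ^ (p - 1)) = v ^ p * z ^ p := by
      rw [mul_left_comm, mul_pow_sub_one hp.out.ne_zero]
    rw [this]
    linear_combination -hvp - v ^ p * hr
  obtain ⟨w, r, hwr⟩ := key
  have hsurj : (⊤ : Submodule (PadicInt p) (L p)) ≤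
      LinearMap.range (LinearMap.mulLeft (PadicInt p) z) := by
    refine Submodule.le_of_le_smul_of_le_jacobson_bot (I := IsLocalRing.maximalIdeal (PadicInt p))
      Module.Finite.fg_top (IsLocalRing.maximalIdeal_le_jacobson _) ?_
    intro a _
    have : a = z * (w * a) + (p : PadicInt p) • (r * a) := by
      rw [Algebra.smul_def, map_natCast]
      linear_combination a * hwr
    rw [this]
    refine Submodule.add_mem_sup ⟨w * a, rfl⟩ (Submodule.smul_mem_smul ?_ trivial)
    rw [IsLocalRing.mem_maximalIdeal, mem_nonunits_iff]
    exact PadicInt.p_nonunit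
  obtain ⟨b, hb⟩ := hsurj (x := 1) trivial
  exact IsUnit.of_mul_eq_one b hb

theorem isUnit_L_iff (z : L p) : IsUnit z ↔ IsUnit (augL p z) :=
  ⟨fun h => h.map _, isUnit_L p z⟩

instance localL : IsLocalRing (L p) := by
  have : IsLocalHom (augL p : L p →+* PadicInt p) := ⟨fun z hz => isUnit_L p z hz⟩
  exact RingHom.domain_isLocalRing (augL p : L p →+* PadicInt p)

theorem nodeL : Node (L p) (NL p) (gL p - 1) where
  xy := NL_mul p
  mx a ha := by
    rw [isUnit_L_iff, ← mem_nonunits_iff, ← IsLocalRing.mem_maximalIdeal,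
      PadicInt.maximalIdeal_eq_span_p, Ideal.mem_span_singleton'] at ha
    obtain ⟨c, hc⟩ := ha
    obtain ⟨h, e⟩ := sub_augL p a
    obtain ⟨h', e'⟩ := sub_augL p (NL p)
    rw [augL_N] at e'
    rw [← hc, map_mul] at e
    refine ⟨algebraMap _ _ c, h - algebraMap _ _ c * h', ?_⟩
    linear_combination e - algebraMap _ _ c * e'
  xn := N_not_nil p
  yn := s_not_nil p
  hx := by
    rw [isUnit_L_iff, augL_N]; exact PadicInt.p_nonunit
  hy := by
    rw [isUnit_L_iff, map_sub, augL_g, map_one, sub_self]; exact not_isUnit_zero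

theorem cardL : Nat.card (IsLocalRing.ResidueField (L p)) = p := by
  let φ : L p →+* ZMod p := (PadicInt.toZMod (p := p)).comp (augL p : L p →+* PadicInt p)
  have hs : Function.Surjective φ := by
    intro a
    obtain ⟨k, rfl⟩ := ZMod.natCast_zmod_surjective a
    exact ⟨k, map_natCast φ k⟩
  have hk : RingHom.ker φ = IsLocalRing.maximalIdeal (L p) := by
    ext z
    rw [IsLocalRing.mem_maximalIdeal, mem_nonunits_iff, isUnit_L_iff, ← mem_nonunits_iff,
      ← IsLocalRing.mem_maximalIdeal, ← PadicInt.ker_toZMod]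
    rfl
  have e := Nat.card_congr (RingHom.quotientKerEquivOfSurjective hs).toEquiv
  have e2 := Nat.card_congr (Ideal.quotEquivOfEq hk).toEquiv
  exact e2.symm.trans (e.trans (Nat.card_zmod p))

end LPart

open Filter in
/-- with `b n` the number of submodules `M ⊆ L` of quotient cardinality `p^n`
and `c n` the number of those that are free, the ratio `c n / b n` tends to `1 − 1/p`:
the density of cohomologically trivial rank-1 quotients of `ℤ_p[G]` is `1 − p⁻¹`. -/
theorem stmt_14 (p : ℕ) [Fact p.Prime] (b c : ℕ → ℕ)
    (hb : ∀ n : ℕ, b n = Nat.card {M : Submodule (L p) (L p) // Nat.card (L p ⧸ M) = p ^ n})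
    (hc : ∀ n : ℕ, c n = Nat.card {M : Submodule (L p) (L p) //
        Nat.card (L p ⧸ M) = p ^ n ∧ Module.Free (L p) M}) :
    Tendsto (fun n : ℕ => (c n : ℝ) / (b n : ℝ)) atTop (nhds (1 - 1 / (p : ℝ))) := by
  have hp : p.Prime := Fact.out
  rw [← tendsto_add_atTop_iff_nat 1]
  have hp0 : (p : ℝ) ≠ 0 := by exact_mod_cast hp.ne_zero
  have key : ∀ n : ℕ, (c (n + 1) : ℝ) / (b (n + 1) : ℝ) =
      ((p : ℝ) - 1) * ((n : ℝ) / ((n : ℝ) + 1 / p)) / p := by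
    intro n
    obtain ⟨h1, h2⟩ := (nodeL p).count p hp (cardL p) n
    rw [hb, hc, h1, h2]
    have hn : (0 : ℝ) < (n : ℝ) * p + 1 := by positivity
    have e2 : ((n * (p - 1) + (n + 1) : ℕ) : ℝ) = (n : ℝ) * p + 1 := by
      push_cast [Nat.cast_sub hp.one_le]; ring
    have e1 : ((n * (p - 1) : ℕ) : ℝ) = (n : ℝ) * (p - 1) := by
      push_cast [Nat.cast_sub hp.one_le]; ring
    rw [e1, e2]
    have e3 : (n : ℝ) + 1 / p = ((n : ℝ) * p + 1) / p := by field_simp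
    rw [e3]
    field_simp
  simp only [key]
  have := ((tendsto_natCast_div_add_atTop (1 / (p : ℝ))).const_mul ((p : ℝ) - 1)).div_const (p : ℝ)
  convert this using 2
  field_simp
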